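/- If T and T' are distinct subsets of {2, 3, 4, …}, then there exists a nonnegative integer k such that the number of ~_T-equivalence classes of words of length k differs from the number of ~_{T'}-equivalence classes of words of length k. Consequently, the map sending T to the rank sequence (k ↦ number of ~_T-classes of length-k words) is injective, so the posets associated to distinct subsets T have distinct rank-generating functions. -/

import Mathlib

/-- The letter `L`, as a one-letter word in the free monoid on the two letters
`{L, R}` (encoded as `Bool`, with `L = false` and `R = true`). -/
def Lw : FreeMonoid Bool := FreeMonoid.of false

/-- The letter `R`, as a one-letter word in the free monoid on `{L, R}`. -/
def Rw : FreeMonoid Bool := FreeMonoid.of true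

/-- The word `w_n = (LR)^n LL`. -/
def wWord (n : ℕ) : FreeMonoid Bool := (Lw * Rw) ^ n * (Lw * Lw)

/-- The word `v_n = RR L^(2n−2) RL`. -/
def vWord (n : ℕ) : FreeMonoid Bool := Rw * Rw * Lw ^ (2 * n - 2) * (Rw * Lw)

/-- The generating relation identifying `w_n` with `v_n` for all `n ∈ T`. -/
def sternRel (T : Set ℕ) : FreeMonoid Bool → FreeMonoid Bool → Prop :=
  fun u v => ∃ n ∈ T, u = wWord n ∧ v = vWord n

/-- `~_T`: the smallest monoid congruence on `{L,R}*` containing the pairs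
`(w_n, v_n)` for all `n ∈ T`. -/
def sternCon (T : Set ℕ) : Con (FreeMonoid Bool) := conGen (sternRel T)
/-- The number of `~_T`-equivalence classes of words of length `k`, i.e. the cardinality
of the `k`-th rank level of the poset associated to `M_T`. -/
noncomputable def classCount (T : Set ℕ) (k : ℕ) : ℕ :=
  Nat.card {q : (sternCon T).Quotient //
    ∃ w : FreeMonoid Bool, w.length = k ∧ (w : (sternCon T).Quotient) = q}

theorem length_wWord (n : ℕ) : (wWord n).length = 2 * n + 2 := by
  have h : ∀ n : ℕ, ((Lw * Rw) ^ n).length = 2 * n := by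
    intro n
    induction n with
    | zero => rfl
    | succ n ih => rw [pow_succ, FreeMonoid.length_mul, ih]; rfl
  rw [wWord, FreeMonoid.length_mul, h]
  rfl

theorem toList_Lw_pow (n : ℕ) : (Lw ^ n).toList = List.replicate n false := by
  induction n with
  | zero => rfl
  | succ n ih => rw [pow_succ', FreeMonoid.toList_mul, ih]; rfl

theorem toList_vWord (n : ℕ) :
    (vWord n).toList = true :: true :: (List.replicate (2 * n - 2) false ++ [true, false]) := by
  rw [vWord, FreeMonoid.toList_mul, FreeMonoid.toList_mul, toList_Lw_pow]
  rfl

theorem length_vWord {n : ℕ} (hn : 2 ≤ n) : (vWord n).length = 2 * n + 2 := by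
  change (vWord n).toList.length = _
  simp [toList_vWord]
  omega

/-- The letters of `v_n`, by position. -/
theorem getElem?_vWord {n : ℕ} (hn : 2 ≤ n) (i : ℕ) :
    (vWord n).toList[i]? =
      if i < 2 then some true else if i < 2 * n then some false
      else if i = 2 * n then some true else if i = 2 * n + 1 then some false else none := by
  rw [toList_vWord]
  rcases i with _ | _ | i
  · simp
  · simp
  · simp only [List.getElem?_cons_succ, List.getElem?_append, List.length_replicate,
      List.getElem?_replicate]
    by_cases h : i < 2 * n - 2
    · rw [if_pos h, if_pos h, if_neg (by omega), if_pos (by omega)]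
    · rw [if_neg h, if_neg (by omega), if_neg (by omega)]
      obtain h | h | h : i - (2 * n - 2) = 0 ∨ i - (2 * n - 2) = 1 ∨ 2 ≤ i - (2 * n - 2) := by
        omega
      · rw [h, if_pos (by omega)]; rfl
      · rw [h, if_neg (by omega), if_pos (by omega)]; rfl
      · rw [if_neg (by omega), if_neg (by omega)]
        exact List.getElem?_eq_none h

theorem mul_wWord_mul_ne_vWord {m n : ℕ} (hm : 2 ≤ m) (hn : 2 ≤ n) (x y : FreeMonoid Bool) :
    x * wWord m * y ≠ vWord n := by
  intro h
  obtain ⟨z, hz⟩ : ∃ z : FreeMonoid Bool, wWord m * y = Lw * Rw * Lw * Rw * z := by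
    obtain ⟨k, rfl⟩ := Nat.exists_eq_add_of_le hm
    exact ⟨(Lw * Rw) ^ k * (Lw * Lw) * y, by simp only [wWord, pow_add, pow_two, mul_assoc]⟩
  rw [mul_assoc, hz] at h
  have key (i : ℕ) :
      (vWord n).toList[x.toList.length + i]? = (false :: true :: false :: true :: z.toList)[i]? := by
    rw [← h, FreeMonoid.toList_mul, List.getElem?_append_right (by omega), Nat.add_sub_cancel_left]
    rfl
  have h0 := key 0
  have h1 := key 1
  have h3 := key 3
  simp only [getElem?_vWord hn, List.getElem?_cons_succ, List.getElem?_cons_zero] at h0 h1 h3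
  grind

theorem eq_of_mul_vWord_mul_eq_vWord {m n : ℕ} (hm : 2 ≤ m) (hn : 2 ≤ n) {x y : FreeMonoid Bool}
    (h : x * vWord m * y = vWord n) : m = n := by
  have key (i : ℕ) (hi : i < 2 * m + 2) :
      (vWord n).toList[x.toList.length + i]? = (vWord m).toList[i]? := by
    have hl : (vWord m).toList.length = 2 * m + 2 := length_vWord hm
    rw [← h, mul_assoc, FreeMonoid.toList_mul, List.getElem?_append_right (by omega),
      Nat.add_sub_cancel_left, FreeMonoid.toList_mul, List.getElem?_append_left (by omega)]
  have h0 := key 0 (by omega)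
  have h1 := key 1 (by omega)
  have h2 := key (2 * m) (by omega)
  simp only [getElem?_vWord hn, getElem?_vWord hm] at h0 h1 h2
  grind

/-- The syntactic congruence of the language `{v}`. -/
def syntacticCon (v : FreeMonoid Bool) : Con (FreeMonoid Bool) where
  r a b := ∀ x y, x * a * y = v ↔ x * b * y = v
  iseqv := ⟨fun _ _ _ => Iff.rfl, fun h x y => (h x y).symm, fun h h' x y => (h x y).trans (h' x y)⟩
  mul' {a b c d} hab hcd x y := by
    have h1 := hab x (c * y)
    have h2 := hcd (x * b) y
    simp only [mul_assoc] at h1 h2 ⊢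
    exact h1.trans h2

/-- If `n ∉ T`, then `v_n` is alone in its class. -/
theorem eq_vWord_of_sternCon {T : Set ℕ} (hT : ∀ m ∈ T, 2 ≤ m) {n : ℕ} (hn : 2 ≤ n) (hnT : n ∉ T)
    {u : FreeMonoid Bool} (h : sternCon T u (vWord n)) : u = vWord n := by
  have hle : sternCon T ≤ syntacticCon (vWord n) := by
    refine Con.conGen_le.mpr ?_
    rintro _ _ ⟨m, hm, rfl, rfl⟩ x y
    refine iff_of_false (mul_wWord_mul_ne_vWord (hT m hm) hn x y) fun hv => hnT ?_
    rwa [← eq_of_mul_vWord_mul_eq_vWord (hT m hm) hn hv]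
  simpa using hle h 1 1

/-- The congruence that preserves length and refines `c` on words of length at most `k`. -/
def truncCon (c : Con (FreeMonoid Bool)) (k : ℕ) : Con (FreeMonoid Bool) where
  r a b := a.length = b.length ∧ (a.length ≤ k → c a b)
  iseqv := ⟨fun a => ⟨rfl, fun _ => c.refl a⟩, fun h => ⟨h.1.symm, fun hk => c.symm (h.2 (h.1 ▸ hk))⟩,
    fun h h' => ⟨h.1.trans h'.1, fun hk => c.trans (h.2 hk) (h'.2 (h.1 ▸ hk))⟩⟩
  mul' {a b a' b'} h h' := by
    simp only [FreeMonoid.length_mul]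
    exact ⟨by rw [h.1, h'.1], fun hk => c.mul (h.2 (by omega)) (h'.2 (by omega))⟩

theorem sternCon_le_truncCon {T T' : Set ℕ} (hT' : ∀ m ∈ T', 2 ≤ m) {n : ℕ}
    (h : ∀ m ≤ n, m ∈ T' → m ∈ T) : sternCon T' ≤ truncCon (sternCon T) (2 * n + 2) := by
  refine Con.conGen_le.mpr ?_
  rintro _ _ ⟨m, hm, rfl, rfl⟩
  refine ⟨by rw [length_wWord, length_vWord (hT' m hm)], fun hk => ?_⟩
  rw [length_wWord] at hk
  exact ConGen.Rel.of _ _ ⟨m, h m (by omega) hm, rfl, rfl⟩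

theorem finite_classes_of_length (c : Con (FreeMonoid Bool)) (k : ℕ) :
    Finite {q : c.Quotient // ∃ w : FreeMonoid Bool, w.length = k ∧ (w : c.Quotient) = q} :=
  ((List.finite_length_eq Bool k).image fun w => ((FreeMonoid.ofList w : FreeMonoid Bool) :
    c.Quotient)).to_subtype

theorem classCount_lt {T T' : Set ℕ} (hT : ∀ m ∈ T, 2 ≤ m) (hT' : ∀ m ∈ T', 2 ≤ m) {n : ℕ}
    (hn : n ∈ T) (hn' : n ∉ T') (h : ∀ m < n, m ∈ T' → m ∈ T) :
    classCount T (2 * n + 2) < classCount T' (2 * n + 2) := by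
  have hle : sternCon T' ≤ truncCon (sternCon T) (2 * n + 2) :=
    sternCon_le_truncCon hT' fun m hm hmT' =>
      h m (lt_of_le_of_ne hm fun e => hn' (e ▸ hmT')) hmT'
  have := finite_classes_of_length (sternCon T') (2 * n + 2)
  let f : {q : (sternCon T').Quotient //
        ∃ w : FreeMonoid Bool, w.length = 2 * n + 2 ∧ (w : (sternCon T').Quotient) = q} →
      {q : (sternCon T).Quotient //
        ∃ w : FreeMonoid Bool, w.length = 2 * n + 2 ∧ (w : (sternCon T).Quotient) = q} :=
    fun q => ⟨(q.2.choose : FreeMonoid Bool), q.2.choose, q.2.choose_spec.1, rfl⟩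
  have hf (w : FreeMonoid Bool) (hw : w.length = 2 * n + 2) :
      f ⟨w, w, hw, rfl⟩ = ⟨w, w, hw, rfl⟩ := by
    have hq : ∃ u : FreeMonoid Bool, u.length = 2 * n + 2 ∧
      (u : (sternCon T').Quotient) = (w : (sternCon T').Quotient) := ⟨w, hw, rfl⟩
    exact Subtype.ext ((Con.eq _).mpr
      ((hle ((Con.eq _).mp hq.choose_spec.2)).2 hq.choose_spec.1.le))
  have hsurj : Function.Surjective f := by
    rintro ⟨_, w, hw, rfl⟩
    exact ⟨_, hf w hw⟩
  refine lt_of_not_ge fun hge => ?_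
  have hinj := (hsurj.bijective_of_nat_card_le hge).1
  have hrel : sternCon T (wWord n) (vWord n) := ConGen.Rel.of _ _ ⟨n, hn, rfl, rfl⟩
  have hv := length_vWord (hT n hn)
  have heq := hinj ((hf _ (length_wWord n)).trans
    ((Subtype.ext ((Con.eq _).mpr hrel)).trans (hf _ hv).symm))
  have hwv := eq_vWord_of_sternCon hT' (hT n hn) hn' ((Con.eq _).mp (congrArg Subtype.val heq))
  exact mul_wWord_mul_ne_vWord (hT n hn) (hT n hn) 1 1 (by simpa using hwv)

/-- If `T` and `T'` are distinct subsets of `{2, 3, 4, …}`, then there exists a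
nonnegative integer `k` such that the number of `~_T`-equivalence classes of words of
length `k` differs from the number of `~_{T'}`-equivalence classes of words of length
`k`. Consequently, the map `T ↦ (k ↦ classCount T k)` is injective on subsets of
`{2, 3, …}`, so the posets associated to distinct subsets have distinct
rank-generating functions. -/
theorem classCount_injective (T T' : Set ℕ) (hT : ∀ n ∈ T, 2 ≤ n)
    (hT' : ∀ n ∈ T', 2 ≤ n) (hne : T ≠ T') :
    ∃ k : ℕ, classCount T k ≠ classCount T' k := by
  classical
  have hex : ∃ n, ¬(n ∈ T ↔ n ∈ T') := by
    by_contra! h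
    exact hne (Set.ext h)
  have hlt : ∀ m < Nat.find hex, (m ∈ T ↔ m ∈ T') := fun m hm => not_not.mp (Nat.find_min hex hm)
  refine ⟨2 * Nat.find hex + 2, ?_⟩
  by_cases h : Nat.find hex ∈ T
  · have h' : Nat.find hex ∉ T' := fun h' => Nat.find_spec hex (iff_of_true h h')
    exact (classCount_lt hT hT' h h' fun m hm => (hlt m hm).mpr).ne
  · have h' : Nat.find hex ∈ T' := by
      by_contra h'
      exact Nat.find_spec hex (iff_of_false h h')
    exact (classCount_lt hT' hT h' h fun m hm => (hlt m hm).mp).ne'
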